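/- arXiv:2006.15664 — 2 statements merged into one kernel-verified Lean document; each statement's English description precedes it below -/
import Mathlib

section
/- The function τ is a metric on the set of angle triples: for all angle triples α, β, γ one has (i) τ(α, β) ≥ 0; (ii) τ(α, β) = 0 if and only if α = β; (iii) τ(α, β) = τ(β, α); and (iv) τ(α, γ) ≤ τ(α, β) + τ(β, γ). -/
/-- An angle triple: the sorted interior angles of a triangle. -/
def IsAngleTriple (a : ℝ × ℝ × ℝ) : Prop :=
  0 < a.1 ∧ a.1 ≤ a.2.1 ∧ a.2.1 ≤ a.2.2 ∧ a.1 + a.2.1 + a.2.2 = Real.pi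

/-- The triangle metric `τ` on angle triples. -/
noncomputable def tau (a b : ℝ × ℝ × ℝ) : ℝ :=
  Real.sqrt ((Real.sin a.2.1 / Real.sin a.2.2) ^ 2 + (Real.sin b.2.1 / Real.sin b.2.2) ^ 2 -
    2 * ((Real.sin a.2.1 * Real.sin b.2.1) / (Real.sin a.2.2 * Real.sin b.2.2)) *
      Real.cos (a.1 - b.1))

/-- The ratio of the middle side to the longest side of the triangle with angles `a`. -/
noncomputable def sideRatio (a : ℝ × ℝ × ℝ) : ℝ :=
  Real.sin a.2.1 / Real.sin a.2.2

/-- The third vertex of the triangle with angles `a` and longest side from `0` to `1`, placed so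
that the smallest angle is at the origin. -/
noncomputable def apex (a : ℝ × ℝ × ℝ) : ℂ :=
  ⟨sideRatio a * Real.cos a.1, sideRatio a * Real.sin a.1⟩

theorem tau_eq_norm_sub (a b : ℝ × ℝ × ℝ) : tau a b = ‖apex a - apex b‖ := by
  rw [tau, Complex.norm_eq_sqrt_sq_add_sq, mul_div_mul_comm, Real.cos_sub]
  congr 1
  simp only [apex, sideRatio, Complex.sub_re, Complex.sub_im]
  linear_combination
    -(Real.sin a.2.1 / Real.sin a.2.2) ^ 2 * Real.sin_sq_add_cos_sq a.1 -
      (Real.sin b.2.1 / Real.sin b.2.2) ^ 2 * Real.sin_sq_add_cos_sq b.1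

theorem apex_injOn : Set.InjOn apex {a | IsAngleTriple a} := by
  rintro ⟨a₀, a₁, a₂⟩ ⟨ha₀, ha₁, ha₂, ha⟩ ⟨b₀, b₁, b₂⟩ ⟨hb₀, hb₁, hb₂, hb⟩ h
  dsimp only at ha₀ ha₁ ha₂ ha hb₀ hb₁ hb₂ hb
  have sa₀ : 0 < Real.sin a₀ := Real.sin_pos_of_pos_of_lt_pi ha₀ (by linarith)
  have sa₁ : 0 < Real.sin a₁ := Real.sin_pos_of_pos_of_lt_pi (by linarith) (by linarith)
  have sa₂ : 0 < Real.sin a₂ := Real.sin_pos_of_pos_of_lt_pi (by linarith) (by linarith)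
  have sb₁ : 0 < Real.sin b₁ := Real.sin_pos_of_pos_of_lt_pi (by linarith) (by linarith)
  have sb₂ : 0 < Real.sin b₂ := Real.sin_pos_of_pos_of_lt_pi (by linarith) (by linarith)
  have ra : Real.sin a₁ / Real.sin a₂ ≠ 0 := (div_pos sa₁ sa₂).ne'
  have rb : Real.sin b₁ / Real.sin b₂ ≠ 0 := (div_pos sb₁ sb₂).ne'
  simp only [apex, sideRatio, Complex.mk.injEq] at h
  obtain ⟨hre, him⟩ := h
  have h₀ : a₀ = b₀ := by
    refine sub_eq_zero.mp
      ((Real.sin_eq_zero_iff_of_lt_of_lt (by linarith) (by linarith)).mp ?_)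
    rw [Real.sin_sub]
    refine (mul_eq_zero_iff_left (mul_ne_zero ra rb)).mp ?_
    linear_combination (Real.sin b₁ / Real.sin b₂ * Real.cos b₀) * him -
      (Real.sin b₁ / Real.sin b₂ * Real.sin b₀) * hre
  subst h₀
  have hr := mul_right_cancel₀ sa₀.ne' him
  rw [div_eq_div_iff sa₂.ne' sb₂.ne'] at hr
  have h₁ : a₁ = b₁ := by
    refine sub_eq_zero.mp
      ((Real.sin_eq_zero_iff_of_lt_of_lt (by linarith) (by linarith)).mp ?_)
    have ea : Real.sin a₂ = Real.sin (a₀ + a₁) := by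
      rw [← Real.sin_pi_sub]; congr 1; linarith
    have eb : Real.sin b₂ = Real.sin (a₀ + b₁) := by
      rw [← Real.sin_pi_sub]; congr 1; linarith
    rw [ea, eb, Real.sin_add, Real.sin_add] at hr
    rw [Real.sin_sub]
    refine (mul_eq_zero_iff_left sa₀.ne').mp ?_
    linear_combination hr
  subst h₁
  have h₂ : a₂ = b₂ := by linarith
  rw [h₂]

/-- `τ` is a metric on the set of angle triples: non-negativity, identity of
indiscernibles, symmetry, and the triangle inequality. -/
theorem tau_is_metric (a b c : ℝ × ℝ × ℝ)
    (ha : IsAngleTriple a) (hb : IsAngleTriple b) (hc : IsAngleTriple c) :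
    0 ≤ tau a b ∧ (tau a b = 0 ↔ a = b) ∧ tau a b = tau b a ∧
      tau a c ≤ tau a b + tau b c := by
  simp only [tau_eq_norm_sub]
  refine ⟨norm_nonneg _, ?_, norm_sub_rev _ _, norm_sub_le_norm_sub_add_norm_sub _ _ _⟩
  rw [norm_sub_eq_zero_iff]
  exact apex_injOn.eq_iff ha hb
end

section
/- For all angle triples α and β, if τ(α, β) = 0 then α = β; that is, two triangles whose sorted interior angle triples have τ-distance zero are similar. -/
/-- Identity of indiscernibles: angle triples at `τ`-distance zero are equal, i.e.
the corresponding triangles are similar. -/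
theorem tau_eq_zero_implies_similar (a b : ℝ × ℝ × ℝ)
    (ha : IsAngleTriple a) (hb : IsAngleTriple b) (h : tau a b = 0) : a = b := by
  obtain ⟨a0, a1, a2⟩ := a
  obtain ⟨b0, b1, b2⟩ := b
  obtain ⟨ha0, ha01, ha12, hasum⟩ := ha
  obtain ⟨hb0, hb01, hb12, hbsum⟩ := hb
  dsimp only [tau] at *
  have hsa1 : 0 < Real.sin a1 := Real.sin_pos_of_pos_of_lt_pi (by linarith) (by linarith)
  have hsa2 : 0 < Real.sin a2 := Real.sin_pos_of_pos_of_lt_pi (by linarith) (by linarith)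
  have hsb1 : 0 < Real.sin b1 := Real.sin_pos_of_pos_of_lt_pi (by linarith) (by linarith)
  have hsb2 : 0 < Real.sin b2 := Real.sin_pos_of_pos_of_lt_pi (by linarith) (by linarith)
  have hsa0 : 0 < Real.sin a0 := Real.sin_pos_of_pos_of_lt_pi ha0 (by linarith)
  rw [Real.sqrt_eq_zero', mul_div_mul_comm] at h
  have hx : 0 < Real.sin a1 / Real.sin a2 := div_pos hsa1 hsa2
  have hy : 0 < Real.sin b1 / Real.sin b2 := div_pos hsb1 hsb2
  have hxy := mul_pos hx hy
  have hratio : Real.sin a1 / Real.sin a2 = Real.sin b1 / Real.sin b2 := by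
    nlinarith [mul_nonneg hxy.le (sub_nonneg.2 (Real.cos_le_one (a0 - b0)))]
  have hcos : Real.cos (a0 - b0) = 1 := by
    refine le_antisymm (Real.cos_le_one _) ?_
    rw [hratio] at h hxy
    nlinarith
  have h0 : a0 = b0 := sub_eq_zero.1
    ((Real.cos_eq_one_iff_of_lt_of_lt (by linarith) (by linarith)).1 hcos)
  subst h0
  rw [div_eq_div_iff hsa2.ne' hsb2.ne', show a2 = Real.pi - (a0 + a1) by linarith,
    show b2 = Real.pi - (a0 + b1) by linarith, Real.sin_pi_sub, Real.sin_pi_sub,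
    Real.sin_add, Real.sin_add] at hratio
  have hprod : Real.sin a0 * Real.sin (a1 - b1) = 0 := by
    rw [Real.sin_sub]
    linear_combination hratio
  have hsin : Real.sin (a1 - b1) = 0 := (mul_eq_zero.1 hprod).resolve_left hsa0.ne'
  have h1 : a1 = b1 := sub_eq_zero.1
    ((Real.sin_eq_zero_iff_of_lt_of_lt (by linarith) (by linarith)).1 hsin)
  subst h1
  have h2 : a2 = b2 := by linarith
  rw [h2]
end
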